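/- arXiv:2402.05688 — 5 statements merged into one kernel-verified Lean document; each statement's English description precedes it below -/
import Mathlib

section
/- Under the standing setup, let t ≥ 0 be such that ξ ≤ ‖e₁(t)‖ < 1 and ‖e₂(t)‖ ≤ 1. Then ⟨e₁(t), e₁'(t)⟩ ≤ 0; that is, the derivative of t ↦ ½‖e₁(t)‖² is nonpositive at t. -/
open scoped RealInnerProductSpace

/-- If `a` pulls `x` inwards strongly enough and `v + a • x` lies in the unit ball, then the velocity
`c • x + v` does not point outwards at `x`. -/
theorem inner_smul_add_nonpos {E : Type*} [NormedAddCommGroup E] [InnerProductSpace ℝ E]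
    {x v : E} {a c L : ℝ} (hc : |c| ≤ L) (hx : ‖x‖ ≤ 1) (ha : 1 + L ≤ a * ‖x‖)
    (hv : ‖v + a • x‖ ≤ 1) : ⟪x, c • x + v⟫ ≤ 0 := by
  have hw : ⟪x, v + a • x⟫ ≤ ‖x‖ :=
    (real_inner_le_norm _ _).trans (mul_le_of_le_one_right (norm_nonneg x) hv)
  simp only [inner_add_right, real_inner_smul_right, real_inner_self_eq_norm_sq] at hw ⊢
  have hL : 0 ≤ L := (abs_nonneg c).trans hc
  have hcx : c * ‖x‖ ≤ L :=
    (mul_le_mul_of_nonneg_right ((le_abs_self c).trans hc) (norm_nonneg x)).trans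
      (mul_le_of_le_one_right hL hx)
  nlinarith [mul_nonneg (norm_nonneg x) (show 0 ≤ a * ‖x‖ - 1 - c * ‖x‖ by linarith)]

/-- Under the standing setup of the paper, if at some time `t ≥ 0` one has
`ξ ≤ ‖e₁(t)‖ < 1` and `‖e₂(t)‖ ≤ 1`, then `⟨e₁(t), e₁'(t)⟩ ≤ 0`, i.e. the
derivative of `t ↦ ½‖e₁(t)‖²` is nonpositive at `t`.
Here `e₁(t) = φ(t)e(t)`, `e₁'(t) = φ'(t)e(t) + φ(t)e'(t)`, and
`e₂(t) = φ(t)e'(t) + α(‖e₁(t)‖²)e₁(t)`. -/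
theorem inner_e1_deriv_nonpos {m : ℕ} (hm : 1 ≤ m)
    (φ φ' : ℝ → ℝ) (φmin Φ L : ℝ)
    (hφd : ∀ s ∈ Set.Ici (0:ℝ), HasDerivAt φ (φ' s) s)
    (hφ'c : ContinuousOn φ' (Set.Ici (0:ℝ)))
    (hφmin0 : 0 < φmin) (hφmin : ∀ s ∈ Set.Ici (0:ℝ), φmin ≤ φ s)
    (hΦ : ∀ s ∈ Set.Ici (0:ℝ), φ s ≤ Φ)
    (hL : ∀ s ∈ Set.Ici (0:ℝ), |φ' s| ≤ L * φ s)
    (α : ℝ → ℝ)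
    (hαcont : ContinuousOn α (Set.Ico (0:ℝ) 1))
    (hαmono : StrictMonoOn α (Set.Ico (0:ℝ) 1))
    (hαbij : Set.BijOn α (Set.Ico (0:ℝ) 1) (Set.Ici (1:ℝ)))
    (e e' : ℝ → EuclideanSpace ℝ (Fin m))
    (he : ∀ s ∈ Set.Ici (0:ℝ), HasDerivAt e (e' s) s)
    (he'c : ContinuousOn e' (Set.Ici (0:ℝ)))
    (ξ : ℝ) (hξ : ξ ∈ Set.Ioo (0:ℝ) 1) (hξeq : α (ξ ^ 2) * ξ = 1 + L)
    (t : ℝ) (ht : 0 ≤ t)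
    (h1lo : ξ ≤ ‖φ t • e t‖) (h1hi : ‖φ t • e t‖ < 1)
    (h2 : ‖φ t • e' t + α (‖φ t • e t‖ ^ 2) • (φ t • e t)‖ ≤ 1) :
    ⟪φ t • e t, φ' t • e t + φ t • e' t⟫ ≤ 0 := by
  have hφt : 0 < φ t := hφmin0.trans_le (hφmin t ht)
  have hc : |φ' t / φ t| ≤ L := by
    rw [abs_div, abs_of_pos hφt, div_le_iff₀ hφt]
    exact hL t ht
  have hsq : ξ ^ 2 ≤ ‖φ t • e t‖ ^ 2 := pow_le_pow_left₀ hξ.1.le h1lo 2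
  have hmem : ‖φ t • e t‖ ^ 2 ∈ Set.Ico (0 : ℝ) 1 :=
    ⟨sq_nonneg _, pow_lt_one₀ (norm_nonneg _) h1hi two_ne_zero⟩
  have hα : α (ξ ^ 2) ≤ α (‖φ t • e t‖ ^ 2) :=
    hαmono.monotoneOn ⟨sq_nonneg _, hsq.trans_lt hmem.2⟩ hmem hsq
  have hα0 : 0 ≤ α (‖φ t • e t‖ ^ 2) := zero_le_one.trans (hαbij.mapsTo hmem)
  have ha : 1 + L ≤ α (‖φ t • e t‖ ^ 2) * ‖φ t • e t‖ :=
    hξeq ▸ mul_le_mul hα h1lo hξ.1.le hα0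
  have key := inner_smul_add_nonpos hc h1hi.le ha h2
  rwa [smul_smul (φ' t / φ t), div_mul_cancel₀ _ hφt.ne'] at key
end

section
/- (Lemma 2 of the paper.) Under the standing setup, let ω ∈ (0,∞] and suppose ‖e₁(0)‖ < 1. If for all t ∈ [0,ω) one has ‖e₁(t)‖ < 1 and ‖e₂(t)‖ ≤ 1, then ‖e₁(t)‖ ≤ ε₁ for all t ∈ [0,ω), where ε₁ := max{‖e₁(0)‖, ξ} < 1. -/
open scoped ENNReal

/-- A field pulled inwards with gain `a` points strictly inwards at `x` as soon as `a * ‖x‖`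
dominates the perturbations of size at most `1` and `L`. -/
lemma inner_neg_of_gain {E : Type*} [NormedAddCommGroup E] [InnerProductSpace ℝ E]
    {x y : E} {k a L : ℝ} (hk : |k| ≤ L) (hy : ‖y‖ ≤ 1) (hx0 : 0 < ‖x‖) (hx1 : ‖x‖ ≤ 1)
    (ha : 1 + L < a * ‖x‖) : inner ℝ x (y - a • x + k • x) < 0 := by
  have hxy : inner ℝ x y ≤ ‖x‖ :=
    (real_inner_le_norm x y).trans (mul_le_of_le_one_right hx0.le hy)
  have hL : 0 ≤ L := (abs_nonneg k).trans hk
  have hkx : k * ‖x‖ ≤ L :=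
    (mul_le_mul_of_nonneg_right ((le_abs_self k).trans hk) hx0.le).trans
      (mul_le_of_le_one_right hL hx1)
  rw [inner_add_right, inner_sub_right, real_inner_smul_right, real_inner_smul_right,
    real_inner_self_eq_norm_sq]
  have hneg : ‖x‖ * (1 - a * ‖x‖ + k * ‖x‖) < 0 :=
    mul_neg_of_pos_of_neg hx0 (by linarith)
  linarith

/-- A curve starting in the closed ball of radius `r` stays there if its velocity points strictly
inwards whenever it is outside of that ball. -/
lemma norm_le_of_inner_deriv_neg {E : Type*} [NormedAddCommGroup E] [InnerProductSpace ℝ E]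
    {f f' : ℝ → E} {a b r : ℝ} (hab : a ≤ b) (hf : ∀ s ∈ Set.Icc a b, HasDerivAt f (f' s) s)
    (hfa : ‖f a‖ ≤ r) (hneg : ∀ s ∈ Set.Icc a b, r < ‖f s‖ → inner ℝ (f s) (f' s) < 0) :
    ‖f b‖ ≤ r := by
  refine le_of_forall_gt_imp_ge_of_dense fun c hc => ?_
  have hc0 : 0 ≤ c := (norm_nonneg _).trans (hfa.trans hc.le)
  have hd : ∀ s ∈ Set.Icc a b,
      HasDerivAt (fun s => ‖f s‖ ^ 2) (2 * inner ℝ (f s) (f' s)) s := fun s hs => (hf s hs).norm_sq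
  refine le_of_sq_le_sq ?_ hc0
  refine image_le_of_deriv_right_lt_deriv_boundary' (f := fun s => ‖f s‖ ^ 2)
    (B := fun _ => c ^ 2) (B' := fun _ => 0)
    (fun s hs => (hd s hs).continuousAt.continuousWithinAt)
    (fun s hs => (hd s (Set.Ico_subset_Icc_self hs)).hasDerivWithinAt)
    (pow_le_pow_left₀ (norm_nonneg _) (hfa.trans hc.le) 2) continuousOn_const
    (fun s _ => hasDerivWithinAt_const _ _ _) (fun s hs hsc => ?_) (Set.right_mem_Icc.2 hab)
  have hsc' : ‖f s‖ = c := (sq_eq_sq₀ (norm_nonneg _) hc0).1 hsc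
  linarith [hneg s (Set.Ico_subset_Icc_self hs) (hsc' ▸ hc)]

/-- Lemma 2 of the paper: under the standing setup, on an interval `[0,ω)`
(`ω ∈ (0,∞]`) on which `‖e₁(t)‖ < 1` and `‖e₂(t)‖ ≤ 1`, and with `‖e₁(0)‖ < 1`,
one has `‖e₁(t)‖ ≤ ε₁ := max{‖e₁(0)‖, ξ}` for all `t ∈ [0,ω)`, and `ε₁ < 1`. -/
theorem e1_bounded_by_eps1 {m : ℕ} (hm : 1 ≤ m)
    (φ φ' : ℝ → ℝ) (φmin Φ L : ℝ)
    (hφd : ∀ s ∈ Set.Ici (0:ℝ), HasDerivAt φ (φ' s) s)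
    (hφ'c : ContinuousOn φ' (Set.Ici (0:ℝ)))
    (hφmin0 : 0 < φmin) (hφmin : ∀ s ∈ Set.Ici (0:ℝ), φmin ≤ φ s)
    (hΦ : ∀ s ∈ Set.Ici (0:ℝ), φ s ≤ Φ)
    (hL : ∀ s ∈ Set.Ici (0:ℝ), |φ' s| ≤ L * φ s)
    (α : ℝ → ℝ)
    (hαcont : ContinuousOn α (Set.Ico (0:ℝ) 1))
    (hαmono : StrictMonoOn α (Set.Ico (0:ℝ) 1))
    (hαbij : Set.BijOn α (Set.Ico (0:ℝ) 1) (Set.Ici (1:ℝ)))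
    (e e' : ℝ → EuclideanSpace ℝ (Fin m))
    (he : ∀ s ∈ Set.Ici (0:ℝ), HasDerivAt e (e' s) s)
    (he'c : ContinuousOn e' (Set.Ici (0:ℝ)))
    (ξ : ℝ) (hξ : ξ ∈ Set.Ioo (0:ℝ) 1) (hξeq : α (ξ ^ 2) * ξ = 1 + L)
    (ω : ℝ≥0∞) (hω : 0 < ω)
    (h0 : ‖φ 0 • e 0‖ < 1)
    (hfunnel : ∀ t : ℝ, 0 ≤ t → ENNReal.ofReal t < ω →
      ‖φ t • e t‖ < 1 ∧
      ‖φ t • e' t + α (‖φ t • e t‖ ^ 2) • (φ t • e t)‖ ≤ 1) :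
    (∀ t : ℝ, 0 ≤ t → ENNReal.ofReal t < ω →
      ‖φ t • e t‖ ≤ max ‖φ 0 • e 0‖ ξ) ∧ max ‖φ 0 • e 0‖ ξ < 1 := by
  refine ⟨fun t ht htω => ?_, max_lt h0 hξ.2⟩
  refine norm_le_of_inner_deriv_neg (f := fun s => φ s • e s)
    (f' := fun s => φ s • e' s + φ' s • e s) ht
    (fun s hs => (hφd s hs.1).fun_smul (he s hs.1)) (le_max_left _ _) fun s hs hlt => ?_
  obtain ⟨hx1, hy⟩ := hfunnel s hs.1 ((ENNReal.ofReal_le_ofReal hs.2).trans_lt htω)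
  have hφpos : 0 < φ s := hφmin0.trans_le (hφmin s hs.1)
  have hξx : ξ < ‖φ s • e s‖ := (le_max_right _ _).trans_lt hlt
  have hx0 : 0 < ‖φ s • e s‖ := hξ.1.trans hξx
  have hξmem : ξ ^ 2 ∈ Set.Ico (0 : ℝ) 1 :=
    ⟨sq_nonneg _, pow_lt_one₀ hξ.1.le hξ.2 two_ne_zero⟩
  have hxmem : ‖φ s • e s‖ ^ 2 ∈ Set.Ico (0 : ℝ) 1 :=
    ⟨sq_nonneg _, pow_lt_one₀ hx0.le hx1 two_ne_zero⟩
  have hα : α (ξ ^ 2) < α (‖φ s • e s‖ ^ 2) :=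
    hαmono hξmem hxmem (pow_lt_pow_left₀ hξx hξ.1.le two_ne_zero)
  have hgain : 1 + L < α (‖φ s • e s‖ ^ 2) * ‖φ s • e s‖ :=
    hξeq ▸ mul_lt_mul'' hα hξx (zero_le_one.trans (hαbij.mapsTo hξmem)) hξ.1.le
  have hk : |φ' s / φ s| ≤ L := by
    rw [abs_div, abs_of_pos hφpos, div_le_iff₀ hφpos]
    exact hL s hs.1
  have h := inner_neg_of_gain hk hy hx0 hx1.le hgain
  rwa [add_sub_cancel_right, smul_smul (φ' s / φ s), div_mul_cancel₀ _ hφpos.ne'] at h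
end

section
/- Under the standing setup, let t ≥ 0 be such that ‖e₁(t)‖ ≤ ε₁ := max{‖e₁(0)‖, ξ} < 1 and ‖e₂(t)‖ ≤ 1. Then ‖e₁'(t)‖ ≤ α(ξ²)ξ + α(ε₁²)ε₁. -/
/-- Under the standing setup, if at time `t ≥ 0` one has `‖e₁(t)‖ ≤ ε₁` and
`‖e₂(t)‖ ≤ 1`, where `ε₁ = max{‖e₁(0)‖, ξ} < 1`, then the derivative
`e₁'(t) = φ'(t)e(t) + φ(t)e'(t)` satisfies
`‖e₁'(t)‖ ≤ α(ξ²)ξ + α(ε₁²)ε₁`. -/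
theorem e1_derivative_bound {m : ℕ} (hm : 1 ≤ m)
    (φ φ' : ℝ → ℝ) (φmin Φ L : ℝ)
    (hφd : ∀ s ∈ Set.Ici (0:ℝ), HasDerivAt φ (φ' s) s)
    (hφ'c : ContinuousOn φ' (Set.Ici (0:ℝ)))
    (hφmin0 : 0 < φmin) (hφmin : ∀ s ∈ Set.Ici (0:ℝ), φmin ≤ φ s)
    (hΦ : ∀ s ∈ Set.Ici (0:ℝ), φ s ≤ Φ)
    (hL : ∀ s ∈ Set.Ici (0:ℝ), |φ' s| ≤ L * φ s)
    (α : ℝ → ℝ)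
    (hαcont : ContinuousOn α (Set.Ico (0:ℝ) 1))
    (hαmono : StrictMonoOn α (Set.Ico (0:ℝ) 1))
    (hαbij : Set.BijOn α (Set.Ico (0:ℝ) 1) (Set.Ici (1:ℝ)))
    (e e' : ℝ → EuclideanSpace ℝ (Fin m))
    (he : ∀ s ∈ Set.Ici (0:ℝ), HasDerivAt e (e' s) s)
    (he'c : ContinuousOn e' (Set.Ici (0:ℝ)))
    (ξ : ℝ) (hξ : ξ ∈ Set.Ioo (0:ℝ) 1) (hξeq : α (ξ ^ 2) * ξ = 1 + L)
    (ε₁ : ℝ) (hε₁ : ε₁ = max ‖φ 0 • e 0‖ ξ) (hε₁lt : ε₁ < 1)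
    (t : ℝ) (ht : 0 ≤ t)
    (h1 : ‖φ t • e t‖ ≤ ε₁)
    (h2 : ‖φ t • e' t + α (‖φ t • e t‖ ^ 2) • (φ t • e t)‖ ≤ 1) :
    ‖φ' t • e t + φ t • e' t‖ ≤ α (ξ ^ 2) * ξ + α (ε₁ ^ 2) * ε₁ := by
  have hφt : 0 < φ t := hφmin0.trans_le (hφmin t ht)
  have hLt := hL t ht
  have hL0 : 0 ≤ L := nonneg_of_mul_nonneg_left ((abs_nonneg _).trans hLt) hφt
  have hx0 : 0 ≤ ‖φ t • e t‖ := norm_nonneg _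
  have hmem : ‖φ t • e t‖ ^ 2 ∈ Set.Ico (0:ℝ) 1 := ⟨by positivity, by nlinarith⟩
  have hmem' : ε₁ ^ 2 ∈ Set.Ico (0:ℝ) 1 := ⟨by positivity, by nlinarith⟩
  have hα_le : α (‖φ t • e t‖ ^ 2) ≤ α (ε₁ ^ 2) :=
    hαmono.monotoneOn hmem hmem' (by gcongr)
  have hα_ge : 1 ≤ α (‖φ t • e t‖ ^ 2) := hαbij.mapsTo hmem
  have hdrift : ‖φ' t • e t‖ ≤ L := by
    have hnorm : ‖φ t • e t‖ = φ t * ‖e t‖ := by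
      rw [norm_smul, Real.norm_of_nonneg hφt.le]
    calc ‖φ' t • e t‖ = |φ' t| * ‖e t‖ := by rw [norm_smul, Real.norm_eq_abs]
      _ ≤ L * φ t * ‖e t‖ := by gcongr
      _ = L * ‖φ t • e t‖ := by rw [hnorm, mul_assoc]
      _ ≤ L := mul_le_of_le_one_right hL0 (h1.trans hε₁lt.le)
  have hgain : ‖α (‖φ t • e t‖ ^ 2) • (φ t • e t)‖ ≤ α (ε₁ ^ 2) * ε₁ := by
    rw [norm_smul, Real.norm_of_nonneg (zero_le_one.trans hα_ge)]
    exact mul_le_mul hα_le h1 hx0 (by linarith)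
  calc ‖φ' t • e t + φ t • e' t‖
      = ‖φ' t • e t + (φ t • e' t + α (‖φ t • e t‖ ^ 2) • (φ t • e t))
          - α (‖φ t • e t‖ ^ 2) • (φ t • e t)‖ := by congr 1; abel
    _ ≤ ‖φ' t • e t‖ + ‖φ t • e' t + α (‖φ t • e t‖ ^ 2) • (φ t • e t)‖
          + ‖α (‖φ t • e t‖ ^ 2) • (φ t • e t)‖ :=
        (norm_sub_le _ _).trans (by gcongr; exact norm_add_le _ _)
    _ ≤ α (ξ ^ 2) * ξ + α (ε₁ ^ 2) * ε₁ := by linarith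
end

section
/- Under the standing setup, assume additionally that α is continuously differentiable with nondecreasing derivative α'. Define γ₁(t) := α(‖e₁(t)‖²)e₁(t). Let t ≥ 0 be such that ‖e₁(t)‖ ≤ ε₁ := max{‖e₁(0)‖, ξ} < 1 and ‖e₂(t)‖ ≤ 1. Then ‖γ₁'(t)‖ ≤ γ̄ := (2α'(ε₁²)ε₁² + α(ε₁²))·(α(ξ²)ξ + α(ε₁²)ε₁). -/
/-- Chain rule for the radial field `v ↦ α(‖v‖²) v` along a curve. -/
theorem hasDerivAt_comp_norm_sq_smul_self {E : Type*} [NormedAddCommGroup E]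
    [InnerProductSpace ℝ E] {α : ℝ → ℝ} {a t : ℝ} {f : ℝ → E} {f' : E}
    (hα : HasDerivAt α a (‖f t‖ ^ 2)) (hf : HasDerivAt f f' t) :
    HasDerivAt (fun s => α (‖f s‖ ^ 2) • f s)
      (α (‖f t‖ ^ 2) • f' + (a * (2 * inner ℝ (f t) f')) • f t) t :=
  (HasDerivAt.comp (h := fun s => ‖f s‖ ^ 2) t hα hf.norm_sq).smul hf

theorem norm_radial_deriv_le {E : Type*} [NormedAddCommGroup E] [InnerProductSpace ℝ E]
    {a c : ℝ} (ha : 0 ≤ a) (hc : 0 ≤ c) (v w : E) :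
    ‖c • w + (a * (2 * inner ℝ v w)) • v‖ ≤ (2 * a * ‖v‖ ^ 2 + c) * ‖w‖ := by
  have hinner : |inner ℝ v w| ≤ ‖v‖ * ‖w‖ := abs_real_inner_le_norm v w
  calc ‖c • w + (a * (2 * inner ℝ v w)) • v‖
      ≤ ‖c • w‖ + ‖(a * (2 * inner ℝ v w)) • v‖ := norm_add_le _ _
    _ = c * ‖w‖ + a * (2 * |inner ℝ v w|) * ‖v‖ := by
        simp only [norm_smul, Real.norm_eq_abs, abs_mul, abs_of_nonneg ha, abs_of_nonneg hc,
          abs_two]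
    _ ≤ c * ‖w‖ + a * (2 * (‖v‖ * ‖w‖)) * ‖v‖ := by gcongr
    _ = (2 * a * ‖v‖ ^ 2 + c) * ‖w‖ := by ring

/-- Bound on the derivative of `γ₁(t) = α(‖e₁(t)‖²)e₁(t)` (constant `γ̄` of
equation (11) of the paper): under the standing setup, with `α` continuously
differentiable with nondecreasing derivative `α'`, if `‖e₁(t)‖ ≤ ε₁` and
`‖e₂(t)‖ ≤ 1` at `t ≥ 0`, then
`‖γ₁'(t)‖ ≤ γ̄ = (2α'(ε₁²)ε₁² + α(ε₁²))(α(ξ²)ξ + α(ε₁²)ε₁)`. -/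
theorem gamma1_derivative_bound {m : ℕ} (hm : 1 ≤ m)
    (φ φ' : ℝ → ℝ) (φmin Φ L : ℝ)
    (hφd : ∀ s ∈ Set.Ici (0:ℝ), HasDerivAt φ (φ' s) s)
    (hφ'c : ContinuousOn φ' (Set.Ici (0:ℝ)))
    (hφmin0 : 0 < φmin) (hφmin : ∀ s ∈ Set.Ici (0:ℝ), φmin ≤ φ s)
    (hΦ : ∀ s ∈ Set.Ici (0:ℝ), φ s ≤ Φ)
    (hL : ∀ s ∈ Set.Ici (0:ℝ), |φ' s| ≤ L * φ s)
    (α α' : ℝ → ℝ)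
    (hαmono : StrictMonoOn α (Set.Ico (0:ℝ) 1))
    (hαbij : Set.BijOn α (Set.Ico (0:ℝ) 1) (Set.Ici (1:ℝ)))
    (hαd : ∀ s ∈ Set.Ico (0:ℝ) 1, HasDerivAt α (α' s) s)
    (hα'c : ContinuousOn α' (Set.Ico (0:ℝ) 1))
    (hα'mono : MonotoneOn α' (Set.Ico (0:ℝ) 1))
    (e e' : ℝ → EuclideanSpace ℝ (Fin m))
    (he : ∀ s ∈ Set.Ici (0:ℝ), HasDerivAt e (e' s) s)
    (he'c : ContinuousOn e' (Set.Ici (0:ℝ)))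
    (ξ : ℝ) (hξ : ξ ∈ Set.Ioo (0:ℝ) 1) (hξeq : α (ξ ^ 2) * ξ = 1 + L)
    (ε₁ γbar : ℝ) (hε₁ : ε₁ = max ‖φ 0 • e 0‖ ξ) (hε₁lt : ε₁ < 1)
    (hγbar : γbar = (2 * α' (ε₁ ^ 2) * ε₁ ^ 2 + α (ε₁ ^ 2)) *
      (α (ξ ^ 2) * ξ + α (ε₁ ^ 2) * ε₁))
    (t : ℝ) (ht : 0 ≤ t)
    (h1 : ‖φ t • e t‖ ≤ ε₁)
    (h2 : ‖φ t • e' t + α (‖φ t • e t‖ ^ 2) • (φ t • e t)‖ ≤ 1) :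
    ∀ D : EuclideanSpace ℝ (Fin m),
      HasDerivAt (fun s => α (‖φ s • e s‖ ^ 2) • (φ s • e s)) D t → ‖D‖ ≤ γbar := by
  intro D hD
  have hε₁0 : 0 ≤ ε₁ := (norm_nonneg _).trans h1
  have hsq : ‖φ t • e t‖ ^ 2 ≤ ε₁ ^ 2 := by gcongr
  have hεmem : ε₁ ^ 2 ∈ Set.Ico (0:ℝ) 1 := ⟨by positivity, by nlinarith⟩
  have hmem : ‖φ t • e t‖ ^ 2 ∈ Set.Ico (0:ℝ) 1 := ⟨by positivity, hsq.trans_lt hεmem.2⟩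
  have hφpos : 0 < φ t := hφmin0.trans_le (hφmin t ht)
  have hL0 : 0 ≤ L := nonneg_of_mul_nonneg_left ((abs_nonneg _).trans (hL t ht)) hφpos
  have hα0 : 0 ≤ α (‖φ t • e t‖ ^ 2) := zero_le_one.trans (hαbij.mapsTo hmem)
  have hαle : α (‖φ t • e t‖ ^ 2) ≤ α (ε₁ ^ 2) := hαmono.monotoneOn hmem hεmem hsq
  have hα'0 : 0 ≤ α' (‖φ t • e t‖ ^ 2) := by
    rw [← (hαd _ hmem).hasDerivWithinAt.derivWithin (uniqueDiffOn_Ico 0 1 _ hmem)]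
    exact hαmono.monotoneOn.derivWithin_nonneg
  have hα'le : α' (‖φ t • e t‖ ^ 2) ≤ α' (ε₁ ^ 2) := hα'mono hmem hεmem hsq
  have hf : HasDerivAt (fun s => φ s • e s) (φ t • e' t + φ' t • e t) t :=
    (hφd t ht).smul (he t ht)
  have hlog : ‖φ' t • e t‖ ≤ L := by
    calc ‖φ' t • e t‖ = |φ' t| * ‖e t‖ := by rw [norm_smul, Real.norm_eq_abs]
      _ ≤ L * φ t * ‖e t‖ := by gcongr; exact hL t ht
      _ = L * ‖φ t • e t‖ := by rw [norm_smul, Real.norm_eq_abs, abs_of_pos hφpos, mul_assoc]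
      _ ≤ L := mul_le_of_le_one_right hL0 (h1.trans hε₁lt.le)
  have hw : ‖φ t • e' t + φ' t • e t‖ ≤ α (ξ ^ 2) * ξ + α (ε₁ ^ 2) * ε₁ := by
    calc ‖φ t • e' t + φ' t • e t‖
        = ‖(φ t • e' t + α (‖φ t • e t‖ ^ 2) • (φ t • e t)) + φ' t • e t
            - α (‖φ t • e t‖ ^ 2) • (φ t • e t)‖ := by congr 1; abel
      _ ≤ ‖φ t • e' t + α (‖φ t • e t‖ ^ 2) • (φ t • e t)‖ + ‖φ' t • e t‖
            + ‖α (‖φ t • e t‖ ^ 2) • (φ t • e t)‖ :=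
          (norm_sub_le _ _).trans (by gcongr; exact norm_add_le _ _)
      _ ≤ 1 + L + α (ε₁ ^ 2) * ε₁ := by
          rw [norm_smul (α _), Real.norm_eq_abs, abs_of_nonneg hα0]
          have := hα0.trans hαle
          gcongr
      _ = α (ξ ^ 2) * ξ + α (ε₁ ^ 2) * ε₁ := by rw [hξeq]
  rw [hD.unique (hasDerivAt_comp_norm_sq_smul_self (f := fun s => φ s • e s) (hαd _ hmem) hf),
    hγbar]
  have h2α' := hα'0.trans hα'le
  have hα_nonneg := hα0.trans hαle
  refine (norm_radial_deriv_le hα'0 hα0 _ _).trans ?_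
  gcongr
end

section
/- (Step 2.b of the proof of Theorem 1.) Let m ≥ 1, λ ∈ (0,1), and positive constants κ₀, κ₁, g_min, g_max, F̃, φ_min, Φ∞, β with φ_min·g_min·β > 2κ₀. Let τ > 0 satisfy τ ≤ κ₀/κ₁² and τ ≤ λ·(φ_min·g_min·β − 2κ₀)/(Φ∞²·F̃·g_max·β). Let ω ∈ (0,τ], let E₀ ∈ ℝ^m with ‖E₀‖ ≥ λ, and set u := −β·E₀/‖E₀‖². Let φ : [0,ω] → ℝ with φ_min ≤ φ(t) ≤ Φ∞, let G(t) be m×m real matrices with ⟨ζ, G(t)ζ⟩ ≥ g_min‖ζ‖² and ‖G(t)ζ‖ ≤ g_max‖ζ‖ for all ζ ∈ ℝ^m, and let J : [0,ω] → ℝ^m with ‖J(t)‖ ≤ κ₀. Suppose e₂ : [0,ω] → ℝ^m is continuously differentiable with ‖e₂(0)‖ ≤ 1, ‖e₂(0) − E₀‖ ≤ τ·Φ∞·F̃, e₂'(t) = J(t) + φ(t)·G(t)·u, and ‖e₂'(t)‖ ≤ κ₁ for all t ∈ [0,ω]. Then ⟨e₂(t), e₂'(t)⟩ ≤ 0 for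 all t ∈ [0,ω] (i.e., t ↦ ½‖e₂(t)‖² is nonincreasing), and in particular ‖e₂(t)‖ ≤ 1 for all t ∈ [0,ω]. -/
open scoped RealInnerProductSpace

section InnerProduct

variable {E : Type*} [NormedAddCommGroup E] [InnerProductSpace ℝ E]

/-- If the field `A` is coercive and bounded, the feedback `-(β / ‖x‖ ^ 2) • x` computed from the
sample `x` produces a decrease in the direction of any `y`, up to the sampling error `‖y - x‖`. -/
lemma inner_apply_feedback_le {A : E →L[ℝ] E} {gmin gmax β r δ : ℝ} {x y : E}
    (hr : 0 < r) (hβ : 0 ≤ β) (hgmax : 0 ≤ gmax) (hx : r ≤ ‖x‖) (hxy : ‖y - x‖ ≤ δ)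
    (hcoer : gmin * ‖x‖ ^ 2 ≤ ⟪x, A x⟫) (hbdd : ‖A x‖ ≤ gmax * ‖x‖) :
    ⟪y, A ((-(β / ‖x‖ ^ 2)) • x)⟫ ≤ -(gmin * β) + δ * gmax * β / r := by
  have hx0 : 0 < ‖x‖ := hr.trans_le hx
  have hδ : 0 ≤ δ := (norm_nonneg _).trans hxy
  have hsplit : ⟪y, A ((-(β / ‖x‖ ^ 2)) • x)⟫
      = -(β / ‖x‖ ^ 2 * ⟪x, A x⟫) + β / ‖x‖ ^ 2 * -⟪y - x, A x⟫ := by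
    rw [map_smul, inner_smul_right, inner_sub_left]
    ring
  have hmain : gmin * β ≤ β / ‖x‖ ^ 2 * ⟪x, A x⟫ :=
    calc gmin * β = β / ‖x‖ ^ 2 * (gmin * ‖x‖ ^ 2) := by field_simp
      _ ≤ _ := by gcongr
  have herr : -⟪y - x, A x⟫ ≤ δ * (gmax * ‖x‖) :=
    calc -⟪y - x, A x⟫ ≤ |⟪y - x, A x⟫| := neg_le_abs _
      _ ≤ ‖y - x‖ * ‖A x‖ := abs_real_inner_le_norm _ _
      _ ≤ δ * (gmax * ‖x‖) := by gcongr
  have herr' : β / ‖x‖ ^ 2 * -⟪y - x, A x⟫ ≤ δ * gmax * β / r :=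
    calc β / ‖x‖ ^ 2 * -⟪y - x, A x⟫ ≤ β / ‖x‖ ^ 2 * (δ * (gmax * ‖x‖)) := by gcongr
      _ = δ * gmax * β / ‖x‖ := by field_simp
      _ ≤ δ * gmax * β / r := by gcongr
  linarith

/-- The norm of a curve whose velocity never points outwards is nonincreasing. -/
lemma antitoneOn_norm_of_inner_deriv_nonpos {f f' : ℝ → E} {a b : ℝ}
    (hf : ∀ t ∈ Set.Icc a b, HasDerivAt f (f' t) t)
    (hinner : ∀ t ∈ Set.Icc a b, ⟪f t, f' t⟫ ≤ 0) :
    AntitoneOn (fun t => ‖f t‖) (Set.Icc a b) := by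
  have hsq : AntitoneOn (fun t => ‖f t‖ ^ 2) (Set.Icc a b) := by
    refine antitoneOn_of_hasDerivWithinAt_nonpos (f' := fun t => 2 * ⟪f t, f' t⟫)
      (convex_Icc a b)
      (fun t ht => (hf t ht).norm_sq.continuousAt.continuousWithinAt)
      (fun t ht => (hf t (interior_subset ht)).norm_sq.hasDerivWithinAt)
      (fun t ht => ?_)
    linarith [hinner t (interior_subset ht)]
  exact fun s hs t ht hst => (sq_le_sq₀ (norm_nonneg _) (norm_nonneg _)).1 (hsq hs ht hst)

end InnerProduct

/-- Step 2.b of the proof of Theorem 1: in the case `‖E(t_k)‖ ≥ λ` of the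
zero-order-hold control law (14), with `u = −β·E₀/‖E₀‖²`, the drift bound
`‖J‖ ≤ κ₀`, the sampling-time conditions `τ ≤ κ₀/κ₁²` and
`τ ≤ λ(φmin·gmin·β − 2κ₀)/(Φ²·F̃·gmax·β)`, one obtains
`⟨e₂(t), e₂'(t)⟩ ≤ 0` on `[0,ω]`, hence `‖e₂(t)‖ ≤ 1` on `[0,ω]`. -/
theorem step2b_decrease {m : ℕ} (hm : 1 ≤ m)
    (lam κ₀ κ₁ gmin gmax Ftil φmin Φ β τ ω : ℝ)
    (hlam : lam ∈ Set.Ioo (0:ℝ) 1)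
    (hκ₀ : 0 < κ₀) (hκ₁ : 0 < κ₁) (hgmin : 0 < gmin) (hgmax : 0 < gmax)
    (hFtil : 0 < Ftil) (hφmin : 0 < φmin) (hΦ : 0 < Φ) (hβ : 0 < β)
    (hβ2 : 2 * κ₀ < φmin * gmin * β)
    (hτ0 : 0 < τ) (hτ1 : τ ≤ κ₀ / κ₁ ^ 2)
    (hτ2 : τ ≤ lam * (φmin * gmin * β - 2 * κ₀) / (Φ ^ 2 * Ftil * gmax * β))
    (hω : ω ∈ Set.Ioc 0 τ)
    (E₀ : EuclideanSpace ℝ (Fin m)) (hE₀ : lam ≤ ‖E₀‖)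
    (u : EuclideanSpace ℝ (Fin m)) (hu : u = (-(β / ‖E₀‖ ^ 2)) • E₀)
    (φ : ℝ → ℝ) (hφ : ∀ t ∈ Set.Icc (0:ℝ) ω, φmin ≤ φ t ∧ φ t ≤ Φ)
    (G : ℝ → EuclideanSpace ℝ (Fin m) →L[ℝ] EuclideanSpace ℝ (Fin m))
    (hG : ∀ t ∈ Set.Icc (0:ℝ) ω, ∀ ζ : EuclideanSpace ℝ (Fin m),
      gmin * ‖ζ‖ ^ 2 ≤ ⟪ζ, G t ζ⟫ ∧ ‖G t ζ‖ ≤ gmax * ‖ζ‖)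
    (J : ℝ → EuclideanSpace ℝ (Fin m))
    (hJ : ∀ t ∈ Set.Icc (0:ℝ) ω, ‖J t‖ ≤ κ₀)
    (e₂ e₂' : ℝ → EuclideanSpace ℝ (Fin m))
    (he₂ : ∀ t ∈ Set.Icc (0:ℝ) ω, HasDerivAt e₂ (e₂' t) t)
    (he₂'c : ContinuousOn e₂' (Set.Icc (0:ℝ) ω))
    (he₂0 : ‖e₂ 0‖ ≤ 1)
    (hE₀close : ‖e₂ 0 - E₀‖ ≤ τ * Φ * Ftil)
    (heq : ∀ t ∈ Set.Icc (0:ℝ) ω, e₂' t = J t + φ t • (G t u))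
    (hbnd : ∀ t ∈ Set.Icc (0:ℝ) ω, ‖e₂' t‖ ≤ κ₁) :
    (∀ t ∈ Set.Icc (0:ℝ) ω, ⟪e₂ t, e₂' t⟫ ≤ 0) ∧
    (∀ t ∈ Set.Icc (0:ℝ) ω, ‖e₂ t‖ ≤ 1) := by
  have hdecr : ∀ t ∈ Set.Icc (0:ℝ) ω, ⟪e₂ t, e₂' t⟫ ≤ 0 := by
    intro t ht
    have h0 : (0:ℝ) ∈ Set.Icc 0 ω := ⟨le_rfl, hω.1.le⟩
    obtain ⟨hφt, hφt'⟩ := hφ t ht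
    have hφ0 : 0 ≤ φ t := hφmin.le.trans hφt
    have hmove : ⟪e₂ t - e₂ 0, e₂' t⟫ ≤ κ₀ := by
      have hlip : ‖e₂ t - e₂ 0‖ ≤ κ₁ * ‖t - 0‖ :=
        (convex_Icc (0:ℝ) ω).norm_image_sub_le_of_norm_hasDerivWithin_le
          (fun s hs => (he₂ s hs).hasDerivWithinAt) hbnd h0 ht
      rw [sub_zero, Real.norm_of_nonneg ht.1] at hlip
      calc ⟪e₂ t - e₂ 0, e₂' t⟫ ≤ ‖e₂ t - e₂ 0‖ * ‖e₂' t‖ := real_inner_le_norm _ _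
        _ ≤ (κ₁ * τ) * κ₁ := by
          gcongr
          · exact hlip.trans (by gcongr; exact ht.2.trans hω.2)
          · exact hbnd t ht
        _ = τ * κ₁ ^ 2 := by ring
        _ ≤ κ₀ := (le_div_iff₀ (by positivity)).1 hτ1
    have hdrift : ⟪e₂ 0, J t⟫ ≤ κ₀ :=
      calc ⟪e₂ 0, J t⟫ ≤ ‖e₂ 0‖ * ‖J t‖ := real_inner_le_norm _ _
        _ ≤ 1 * κ₀ := by
          gcongr
          exact hJ t ht
        _ = κ₀ := one_mul _
    have hcontrol : φ t * ⟪e₂ 0, G t u⟫ ≤ -(2 * κ₀) := by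
      have hfb : ⟪e₂ 0, G t u⟫ ≤ -(gmin * β) + τ * Φ * Ftil * gmax * β / lam := by
        rw [hu]
        exact inner_apply_feedback_le hlam.1 hβ.le hgmax.le hE₀ hE₀close
          (hG t ht E₀).1 (hG t ht E₀).2
      have hlam0 : 0 < lam := hlam.1
      have hsample : Φ * (τ * Φ * Ftil * gmax * β / lam) ≤ φmin * gmin * β - 2 * κ₀ := by
        rw [le_div_iff₀ (by positivity)] at hτ2
        rw [mul_div_assoc', div_le_iff₀ hlam0]
        linarith
      calc φ t * ⟪e₂ 0, G t u⟫
          ≤ φ t * (-(gmin * β) + τ * Φ * Ftil * gmax * β / lam) := by gcongr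
        _ = -(φ t * (gmin * β)) + φ t * (τ * Φ * Ftil * gmax * β / lam) := by ring
        _ ≤ -(φmin * (gmin * β)) + Φ * (τ * Φ * Ftil * gmax * β / lam) := by gcongr
        _ ≤ -(2 * κ₀) := by linarith
    have hsplit : ⟪e₂ t, e₂' t⟫
        = ⟪e₂ t - e₂ 0, e₂' t⟫ + (⟪e₂ 0, J t⟫ + φ t * ⟪e₂ 0, G t u⟫) := by
      rw [← real_inner_smul_right, ← inner_add_right, ← heq t ht, ← inner_add_left, sub_add_cancel]
    linarith
  refine ⟨hdecr, fun t ht => ?_⟩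
  exact (antitoneOn_norm_of_inner_deriv_nonpos he₂ hdecr ⟨le_rfl, hω.1.le⟩ ht ht.1).trans he₂0
end
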